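/- Let (X,κ_A) be a pair of (possibly dependent) nonnegative random variables with κ=E[κ_A]<1 and E[X]<∞, and let D be a nonnegative random variable whose Laplace transform φ(s)=E[e^{−sD}] satisfies φ(s)=E[e^{−sX}·e^{κ_A(φ(s)−1)}] for all s≥0; set μ_D=E[X]/(1−κ). If X is regularly varying with index α∈(1,2) and, in addition, Y=X+κ_A·μ_D is regularly varying with index α, then D is regularly varying with the same index α; more precisely, P(D>x) ~ P(Y>x)/(1−κ) as x→∞. -/

import Mathlib

open MeasureTheory ProbabilityTheory Filter

/-- A function `ℓ` is slowly varying (at infinity) if `ℓ(c x)/ℓ(x) → 1` for every `c > 0`. -/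
def SlowlyVarying (ℓ : ℝ → ℝ) : Prop :=
  ∀ c : ℝ, 0 < c → Tendsto (fun x => ℓ (c * x) / ℓ x) atTop (nhds 1)

/-- A random variable `Z` is regularly varying with index `α` if
`P(Z > x) = x^(-α) ℓ(x)` for some slowly varying `ℓ`. -/
def RegularlyVarying {Ω : Type*} [MeasurableSpace Ω] (P : Measure Ω)
    (Z : Ω → ℝ) (α : ℝ) : Prop :=
  ∃ ℓ : ℝ → ℝ, SlowlyVarying ℓ ∧
    ∀ x : ℝ, 0 < x → (P {ω | x < Z ω}).toReal = x ^ (-α) * ℓ x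


noncomputable def hkg (t : ℝ) : ℝ := Real.exp (-t) - 1 + t

lemma hkg_nonneg (t : ℝ) : 0 ≤ hkg t := by
  unfold hkg; linarith [Real.add_one_le_exp (-t)]

lemma hkg_le_self {t : ℝ} (ht : 0 ≤ t) : hkg t ≤ t := by
  unfold hkg
  have : Real.exp (-t) ≤ 1 := Real.exp_le_one_iff.mpr (by linarith)
  linarith

lemma hk_diff {a b : ℝ} : hkg b - hkg a ≤ (b - a) * (1 - Real.exp (-b)) := by
  unfold hkg
  have h1 := Real.add_one_le_exp (b - a)
  have h2 : Real.exp (-a) = Real.exp (-b) * Real.exp (b - a) := by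
    rw [← Real.exp_add]; ring_nf
  have h3 := Real.exp_pos (-b)
  rw [h2]
  nlinarith

lemma hkg_mono {a b : ℝ} (ha : 0 ≤ a) (hab : a ≤ b) : hkg a ≤ hkg b := by
  have := @hk_diff b a
  have h : Real.exp (-a) ≤ 1 := Real.exp_le_one_iff.mpr (by linarith)
  nlinarith

lemma hkg_le_sq {t : ℝ} (ht : 0 ≤ t) : hkg t ≤ t ^ 2 := by
  have h := @hk_diff 0 t
  have h0 : hkg 0 = 0 := by simp [hkg]
  have h1 := Real.add_one_le_exp (-t)
  rw [h0] at h
  nlinarith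

noncomputable def hkm (t : ℝ) : ℝ := min (t ^ 2) t

lemma hkg_le_hkm {t : ℝ} (ht : 0 ≤ t) : hkg t ≤ hkm t := le_min (hkg_le_sq ht) (hkg_le_self ht)

lemma hk_diff_le {t : ℝ} (ht : 0 ≤ t) : t * (1 - Real.exp (-t)) ≤ hkm t := by
  have h1 := Real.add_one_le_exp (-t)
  have h2 := Real.exp_pos (-t)
  refine le_min ?_ ?_ <;> nlinarith

lemma hkm_nonneg {t : ℝ} (ht : 0 ≤ t) : 0 ≤ hkm t := le_min (sq_nonneg _) ht

section
variable {Ω : Type*} [MeasurableSpace Ω] (P : Measure Ω) [IsProbabilityMeasure P]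

lemma hk_tail_anti (Y : Ω → ℝ) {x y : ℝ} (h : x ≤ y) :
    P.real {ω | y < Y ω} ≤ P.real {ω | x < Y ω} :=
  measureReal_mono (fun ω hω => lt_of_le_of_lt h hω)

lemma hk_rv_pos {Y : Ω → ℝ} {α : ℝ} (h : RegularlyVarying P Y α) (x : ℝ) :
    0 < P.real {ω | x < Y ω} := by
  obtain ⟨l, hl, hF⟩ := h
  have h1 : ∀ᶠ y in atTop, 0 < l (1 * y) / l y :=
    (hl 1 one_pos).eventually (lt_mem_nhds (by norm_num))
  obtain ⟨y, hy, hyx, hy0⟩ := (h1.and ((eventually_ge_atTop x).and (eventually_gt_atTop 0))).exists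
  refine lt_of_lt_of_le ?_ (hk_tail_anti P Y hyx)
  refine lt_of_le_of_ne measureReal_nonneg (Ne.symm ?_)
  have := hF y hy0
  rw [Measure.real, this]
  have hly : l y ≠ 0 := by
    intro h; simp [h] at hy
  exact mul_ne_zero (Real.rpow_pos_of_pos hy0 _).ne' hly

lemma hk_rv_lim {Y : Ω → ℝ} {α : ℝ} (h : RegularlyVarying P Y α) {c : ℝ} (hc : 0 < c) :
    Tendsto (fun x => P.real {ω | c * x < Y ω} / P.real {ω | x < Y ω}) atTop
      (nhds (c ^ (-α))) := by
  obtain ⟨l, hl, hF⟩ := h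
  have h1 := (hl c hc).const_mul (c ^ (-α))
  rw [mul_one] at h1
  refine h1.congr' ?_
  filter_upwards [eventually_gt_atTop 0] with x hx
  have e1 := hF x hx
  have e2 := hF (c * x) (by positivity)
  simp only [Measure.real]
  rw [e1, e2, Real.mul_rpow hc.le hx.le]
  have := (Real.rpow_pos_of_pos hx (-α)).ne'
  by_cases hlx : l x = 0
  · simp [hlx]
  · field_simp

lemma hk_A_tendsto {Y : Ω → ℝ} (hY : Measurable Y) (hi : Integrable Y P) :
    Tendsto (fun T => ∫ ω in {ω | T < Y ω}, Y ω ∂P) atTop (nhds 0) := by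
  have : ∀ T, ∫ ω in {ω | T < Y ω}, Y ω ∂P = ∫ ω, Set.indicator {ω | T < Y ω} Y ω ∂P := by
    intro T
    rw [integral_indicator (measurableSet_lt measurable_const hY)]
  simp_rw [this]
  have h0 : (0:ℝ) = ∫ ω, (0:ℝ) ∂P := by simp
  rw [h0]
  refine tendsto_integral_filter_of_dominated_convergence (fun ω => |Y ω|) ?_ ?_ hi.abs ?_
  · exact Eventually.of_forall fun T =>
      (hY.indicator (measurableSet_lt measurable_const hY)).aestronglyMeasurable
  · refine Eventually.of_forall fun T => Eventually.of_forall fun ω => ?_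
    exact norm_indicator_le_norm_self _ _
  · refine Eventually.of_forall fun ω => ?_
    refine tendsto_const_nhds.congr' ?_
    filter_upwards [eventually_ge_atTop (Y ω)] with T hT
    rw [Set.indicator_of_notMem]
    simpa using hT

lemma hk_A_ge {Y : Ω → ℝ} (hY : Measurable Y) (hi : Integrable Y P) (T : ℝ) :
    T * P.real {ω | T < Y ω} ≤ ∫ ω in {ω | T < Y ω}, Y ω ∂P := by
  have := setIntegral_mono_on (μ := P) (s := {ω | T < Y ω}) (f := fun _ => T) (g := Y)
    (by simp) hi.integrableOn (measurableSet_lt measurable_const hY)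
    (fun ω hω => le_of_lt hω)
  simpa [mul_comm] using this

lemma hk_A_step {Y : Ω → ℝ} (hY : Measurable Y) (hi : Integrable Y P) {T : ℝ} (hT : 0 < T) :
    ∫ ω in {ω | T < Y ω}, Y ω ∂P ≤ ∫ ω in {ω | 2 * T < Y ω}, Y ω ∂P
      + 2 * T * P.real {ω | T < Y ω} := by
  have hm : ∀ T, MeasurableSet {ω | T < Y ω} := fun T => measurableSet_lt measurable_const hY
  rw [← integral_indicator (hm _), ← integral_indicator (hm _)]
  have e : 2 * T * P.real {ω | T < Y ω} = ∫ ω, Set.indicator {ω | T < Y ω} (fun _ => 2 * T) ω ∂P := by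
    rw [integral_indicator (hm _)]; simp [mul_comm]
  have hc : Integrable (Set.indicator {ω | T < Y ω} (fun _ => 2 * T)) P :=
    (integrable_const _).indicator (hm _)
  rw [e, ← integral_add (hi.indicator (hm _)) hc]
  refine integral_mono (hi.indicator (hm _)) ((hi.indicator (hm _)).add hc) fun ω => ?_
  simp only [Set.indicator, Set.mem_ofPred_eq]
  split_ifs <;> linarith

lemma hk_A_bound {Y : Ω → ℝ} (hY : Measurable Y) (hi : Integrable Y P)
    {α : ℝ} (hα : 1 < α) (h : RegularlyVarying P Y α) :
    ∃ K, 0 ≤ K ∧ ∀ᶠ T in atTop, ∫ ω in {ω | T < Y ω}, Y ω ∂P ≤ K * T * P.real {ω | T < Y ω} := by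
  have hlt : (2:ℝ) ^ (-α) < 1 / 2 := by
    have : (2:ℝ) ^ (-α) < 2 ^ (-1 : ℝ) := Real.rpow_lt_rpow_of_exponent_lt (by norm_num) (by linarith)
    rw [Real.rpow_neg_one] at this
    linarith
  obtain ⟨q, hq1, hq2⟩ := exists_between hlt
  have hq0 : 0 < q := lt_trans (by positivity) hq1
  obtain ⟨T0, hT0⟩ := eventually_atTop.mp ((hk_rv_lim P h two_pos).eventually (gt_mem_nhds hq1))
  set K := 2 / (1 - 2 * q) with hK
  have hd : 0 < 1 - 2 * q := by linarith
  have hK0 : 0 < K := by positivity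
  have hKe : K * (2 * q) + 2 = K := by rw [hK]; field_simp; ring
  have key : ∀ n : ℕ, ∀ T, max T0 1 ≤ T → ∫ ω in {ω | T < Y ω}, Y ω ∂P ≤
      ∫ ω in {ω | 2 ^ n * T < Y ω}, Y ω ∂P + K * T * P.real {ω | T < Y ω} := by
    intro n
    induction n with
    | zero =>
      intro T hT
      have : 0 < T := by linarith [le_max_right T0 1]
      have : 0 ≤ K * T * P.real {ω | T < Y ω} := by positivity
      simpa using this
    | succ n ih =>
      intro T hT
      have hTp : 0 < T := by linarith [le_max_right T0 1]
      have h1 := hk_A_step P hY hi hTp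
      have h2 := ih (2 * T) (by linarith)
      have h3 := hT0 T (le_trans (le_max_left _ _) hT)
      rw [div_lt_iff₀ (hk_rv_pos P h T)] at h3
      have e : (2:ℝ) ^ n * (2 * T) = 2 ^ (n + 1) * T := by ring
      rw [e] at h2
      have h4 : K * (2 * T) * P.real {ω | 2 * T < Y ω} ≤ K * (2 * T) * (q * P.real {ω | T < Y ω}) := by
        gcongr
      have h5 : K * (2 * T) * (q * P.real {ω | T < Y ω}) + 2 * T * P.real {ω | T < Y ω}
          = K * T * P.real {ω | T < Y ω} := by
        calc _ = (K * (2 * q) + 2) * T * P.real {ω | T < Y ω} := by ring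
          _ = _ := by rw [hKe]
      linarith
  refine ⟨K, hK0.le, ?_⟩
  filter_upwards [eventually_ge_atTop (max T0 1)] with T hT
  have hTp : 0 < T := by linarith [le_max_right T0 1]
  have hl : Tendsto (fun n : ℕ => (2:ℝ) ^ n * T) atTop atTop :=
    (tendsto_pow_atTop_atTop_of_one_lt (by norm_num)).atTop_mul_const hTp
  have := ((hk_A_tendsto P hY hi).comp hl).add_const (K * T * P.real {ω | T < Y ω})
  rw [zero_add] at this
  exact ge_of_tendsto' this (fun n => key n T hT)

lemma hk_B_int {Y : Ω → ℝ} (hY : Measurable Y) (hY0 : ∀ ω, 0 ≤ Y ω) (T : ℝ) :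
    Integrable (Set.indicator {ω | Y ω ≤ T} (fun ω => Y ω ^ 2)) P := by
  refine Integrable.of_bound
    ((hY.pow_const 2).indicator (measurableSet_le hY measurable_const)).aestronglyMeasurable (T ^ 2) ?_
  refine Eventually.of_forall fun ω => ?_
  simp only [Set.indicator, Set.mem_ofPred_eq]
  split_ifs with h
  · rw [Real.norm_of_nonneg (by positivity)]
    have := hY0 ω
    gcongr
  · simp; positivity

lemma hk_B_step {Y : Ω → ℝ} (hY : Measurable Y) (hY0 : ∀ ω, 0 ≤ Y ω) {T : ℝ} (hT : 0 < T) :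
    ∫ ω, Set.indicator {ω | Y ω ≤ 2 * T} (fun ω => Y ω ^ 2) ω ∂P ≤
      ∫ ω, Set.indicator {ω | Y ω ≤ T} (fun ω => Y ω ^ 2) ω ∂P
      + 4 * T ^ 2 * P.real {ω | T < Y ω} := by
  have hm : ∀ T, MeasurableSet {ω | T < Y ω} := fun T => measurableSet_lt measurable_const hY
  have e : 4 * T ^ 2 * P.real {ω | T < Y ω}
      = ∫ ω, Set.indicator {ω | T < Y ω} (fun _ => 4 * T ^ 2) ω ∂P := by
    rw [integral_indicator (hm _)]; simp [mul_comm]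
  have hc : Integrable (Set.indicator {ω | T < Y ω} (fun _ => 4 * T ^ 2)) P :=
    (integrable_const _).indicator (hm _)
  rw [e, ← integral_add (hk_B_int P hY hY0 _) hc]
  refine integral_mono (hk_B_int P hY hY0 _) ((hk_B_int P hY hY0 _).add hc) fun ω => ?_
  have := hY0 ω
  simp only [Set.indicator, Set.mem_ofPred_eq]
  split_ifs <;> nlinarith

lemma hk_B_bound {Y : Ω → ℝ} (hY : Measurable Y) (hY0 : ∀ ω, 0 ≤ Y ω)
    {α : ℝ} (hα : α < 2) (h : RegularlyVarying P Y α) :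
    ∃ K, 0 ≤ K ∧ ∀ᶠ T in atTop, ∫ ω, Set.indicator {ω | Y ω ≤ T} (fun ω => Y ω ^ 2) ω ∂P
      ≤ K * T ^ 2 * P.real {ω | T < Y ω} := by
  have hlt : 1 / 4 < (2:ℝ) ^ (-α) := by
    have : (2:ℝ) ^ (-2 : ℝ) < 2 ^ (-α) := Real.rpow_lt_rpow_of_exponent_lt (by norm_num) (by linarith)
    rw [Real.rpow_neg (by norm_num)] at this
    norm_num at this ⊢
    linarith
  obtain ⟨q, hq1, hq2⟩ := exists_between hlt
  obtain ⟨T1, hT1⟩ := eventually_atTop.mp ((hk_rv_lim P h two_pos).eventually (lt_mem_nhds hq2))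
  set T0 := max T1 1
  have hT0p : 0 < T0 := lt_of_lt_of_le one_pos (le_max_right T1 1)
  set K := max (4 / (4 * q - 1)) (4 / P.real {ω | 2 * T0 < Y ω}) with hK
  have hd : 0 < 4 * q - 1 := by linarith
  have hK0 : 0 < K := lt_of_lt_of_le (by positivity) (le_max_left _ _)
  have hKe : K + 4 ≤ 4 * q * K := by
    have : 4 / (4 * q - 1) ≤ K := le_max_left _ _
    rw [div_le_iff₀ hd] at this
    linarith
  have hF0 := hk_rv_pos P h (2 * T0)
  have hKf : 4 ≤ K * P.real {ω | 2 * T0 < Y ω} := by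
    have : 4 / P.real {ω | 2 * T0 < Y ω} ≤ K := le_max_right _ _
    rwa [div_le_iff₀ hF0] at this
  have key : ∀ n : ℕ, ∀ T, T0 ≤ T → T ≤ 2 ^ (n + 1) * T0 →
      ∫ ω, Set.indicator {ω | Y ω ≤ T} (fun ω => Y ω ^ 2) ω ∂P
      ≤ K * T ^ 2 * P.real {ω | T < Y ω} := by
    have base : ∀ T, T0 ≤ T → T ≤ 2 * T0 →
      ∫ ω, Set.indicator {ω | Y ω ≤ T} (fun ω => Y ω ^ 2) ω ∂P
      ≤ K * T ^ 2 * P.real {ω | T < Y ω} := by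
      intro T h1 h2
      have hb : ∫ ω, Set.indicator {ω | Y ω ≤ T} (fun ω => Y ω ^ 2) ω ∂P ≤ ∫ ω, T ^ 2 ∂P := by
        refine integral_mono (hk_B_int P hY hY0 _) (integrable_const _) fun ω => ?_
        have := hY0 ω
        simp only [Set.indicator, Set.mem_ofPred_eq]
        split_ifs <;> nlinarith
      simp at hb
      have h3 : 4 ≤ K * P.real {ω | T < Y ω} :=
        hKf.trans (mul_le_mul_of_nonneg_left (hk_tail_anti P Y h2) hK0.le)
      nlinarith [sq_nonneg T]
    intro n
    induction n with
    | zero =>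
      intro T h1 h2
      exact base T h1 (by simpa using h2)
    | succ n ih =>
      intro T h1 h2
      rcases le_total T (2 * T0) with h3 | h3
      · exact base T h1 h3
      have hi := ih (T / 2) (by linarith) (by rw [pow_succ] at h2; linarith)
      have hs := hk_B_step P hY hY0 (T := T / 2) (by linarith)
      have hr := hT1 (T / 2) (le_trans (le_max_left T1 1) (by linarith))
      rw [lt_div_iff₀ (hk_rv_pos P h _)] at hr
      have e : 2 * (T / 2) = T := by ring
      rw [e] at hs hr
      set f := P.real {ω | T / 2 < Y ω} with hf
      have hfp : 0 < f := hk_rv_pos P h _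
      have h5 : (K + 4) * (T / 2) ^ 2 * f ≤ K * T ^ 2 * P.real {ω | T < Y ω} := by
        calc (K + 4) * (T / 2) ^ 2 * f ≤ (4 * q * K) * (T / 2) ^ 2 * f := by gcongr
          _ = K * T ^ 2 * (q * f) := by ring
          _ ≤ _ := by gcongr
      linarith
  refine ⟨K, hK0.le, ?_⟩
  filter_upwards [eventually_ge_atTop T0] with T hT
  obtain ⟨n, hn⟩ := pow_unbounded_of_one_lt (T / T0) (one_lt_two)
  refine key n T hT ?_
  rw [div_lt_iff₀ hT0p] at hn
  refine hn.le.trans ?_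
  gcongr
  · norm_num
  · simp

lemma hkm_meas : Measurable hkm := by unfold hkm; fun_prop
lemma hkg_meas : Measurable hkg := by unfold hkg; fun_prop

lemma hkm_int {Y : Ω → ℝ} (hY : Measurable Y) (hY0 : ∀ ω, 0 ≤ Y ω) (hi : Integrable Y P) :
    Integrable (fun ω => hkm (Y ω)) P :=
  hi.mono' (hkm_meas.comp hY).aestronglyMeasurable (Eventually.of_forall fun ω => by
    rw [Real.norm_of_nonneg (hkm_nonneg (hY0 ω))]; exact min_le_right _ _)

lemma hkg_int {Y : Ω → ℝ} (hY : Measurable Y) (hY0 : ∀ ω, 0 ≤ Y ω) (hi : Integrable Y P) :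
    Integrable (fun ω => hkg (Y ω)) P :=
  hi.mono' (hkg_meas.comp hY).aestronglyMeasurable (Eventually.of_forall fun ω => by
    rw [Real.norm_of_nonneg (hkg_nonneg _)]; exact hkg_le_self (hY0 ω))

lemma hk_H_bound {Y : Ω → ℝ} (hY : Measurable Y) (hY0 : ∀ ω, 0 ≤ Y ω) (hi : Integrable Y P)
    {α : ℝ} (hα1 : 1 < α) (hα : α < 2) (h : RegularlyVarying P Y α) :
    ∃ K, 0 ≤ K ∧ ∀ᶠ T in atTop, ∫ ω, hkm (1 / T * Y ω) ∂P ≤ K * P.real {ω | T < Y ω} := by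
  obtain ⟨K1, hK1, h1⟩ := hk_A_bound P hY hi hα1 h
  obtain ⟨K2, hK2, h2⟩ := hk_B_bound P hY hY0 hα h
  refine ⟨K1 + K2, by positivity, ?_⟩
  filter_upwards [h1, h2, eventually_gt_atTop 0] with T h1 h2 hT
  have hm : MeasurableSet {ω | T < Y ω} := measurableSet_lt measurable_const hY
  rw [← integral_indicator hm] at h1
  have hle : ∫ ω, hkm (1 / T * Y ω) ∂P ≤
      ∫ ω, (1 / T * Set.indicator {ω | T < Y ω} Y ω
        + 1 / T ^ 2 * Set.indicator {ω | Y ω ≤ T} (fun ω => Y ω ^ 2) ω) ∂P := by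
    refine integral_mono (hkm_int P (by fun_prop) (fun ω => ?_) (hi.const_mul _))
      (((hi.indicator hm).const_mul _).add ((hk_B_int P hY hY0 T).const_mul _)) fun ω => ?_
    · have := hY0 ω; positivity
    · simp only [Set.indicator, Set.mem_ofPred_eq]
      by_cases hw : T < Y ω
      · simp only [hw, not_le.mpr hw, if_true, if_false, mul_zero, add_zero]
        exact min_le_right _ _
      · simp only [hw, not_lt.mp hw, if_true, if_false, mul_zero, zero_add]
        refine (min_le_left _ _).trans (le_of_eq ?_)
        field_simp
  rw [integral_add ((hi.indicator hm).const_mul _) ((hk_B_int P hY hY0 T).const_mul _),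
    integral_const_mul, integral_const_mul] at hle
  refine hle.trans ?_
  have e1 : 1 / T * ∫ ω, Set.indicator {ω | T < Y ω} Y ω ∂P
      ≤ 1 / T * (K1 * T * P.real {ω | T < Y ω}) := by gcongr
  have e2 : 1 / T ^ 2 * ∫ ω, Set.indicator {ω | Y ω ≤ T} (fun ω => Y ω ^ 2) ω ∂P
      ≤ 1 / T ^ 2 * (K2 * T ^ 2 * P.real {ω | T < Y ω}) := by gcongr
  have e3 : 1 / T * (K1 * T * P.real {ω | T < Y ω}) = K1 * P.real {ω | T < Y ω} := by field_simp
  have e4 : 1 / T ^ 2 * (K2 * T ^ 2 * P.real {ω | T < Y ω}) = K2 * P.real {ω | T < Y ω} := by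
    field_simp
  linarith

end

section
variable {Ω : Type*} [MeasurableSpace Ω] (P : Measure Ω) [IsProbabilityMeasure P]

noncomputable def hkI (P : Measure Ω) (Z : Ω → ℝ) (f : ℝ → ℝ) (T : ℝ) : ℝ :=
  ∫ ω, (1 - Real.exp (-(1 / T * Z ω))) ^ 2 * f (Real.exp (-(1 / T * Z ω))) ∂P

lemma hk_exp_mem {Z T : ℝ} (hZ : 0 ≤ Z) (hT : 0 < T) :
    Real.exp (-(1 / T * Z)) ∈ Set.Icc (0:ℝ) 1 := by
  refine ⟨(Real.exp_pos _).le, Real.exp_le_one_iff.mpr ?_⟩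
  have : 0 ≤ 1 / T * Z := by positivity
  linarith

lemma hkI_int {Z : Ω → ℝ} (hZ : Measurable Z) (hZ0 : ∀ ω, 0 ≤ Z ω) {f : ℝ → ℝ}
    (hf : Continuous f) {T : ℝ} (hT : 0 < T) :
    Integrable (fun ω => (1 - Real.exp (-(1 / T * Z ω))) ^ 2 * f (Real.exp (-(1 / T * Z ω)))) P := by
  obtain ⟨C, hC⟩ := isCompact_Icc.exists_bound_of_continuousOn (s := Set.Icc (0:ℝ) 1) hf.continuousOn
  refine Integrable.of_bound (Measurable.aestronglyMeasurable ?_) C ?_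
  · have := hf.measurable
    fun_prop
  · refine Eventually.of_forall fun ω => ?_
    have h1 := hk_exp_mem (hZ0 ω) hT
    have h2 := hC _ h1
    rw [norm_mul, Real.norm_of_nonneg (sq_nonneg _)]
    have h3 : (1 - Real.exp (-(1 / T * Z ω))) ^ 2 ≤ 1 := by
      have := h1.1; have := h1.2
      nlinarith
    have := norm_nonneg (f (Real.exp (-(1 / T * Z ω))))
    nlinarith [sq_nonneg (1 - Real.exp (-(1 / T * Z ω)))]

lemma hkI_sub {Z : Ω → ℝ} (hZ : Measurable Z) (hZ0 : ∀ ω, 0 ≤ Z ω) {f p : ℝ → ℝ}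
    (hf : Continuous f) (hp : Continuous p) {ε : ℝ}
    (h : ∀ z ∈ Set.Icc (0:ℝ) 1, |p z - f z| ≤ ε) {T : ℝ} (hT : 0 < T) :
    |hkI P Z f T - hkI P Z p T| ≤ ε * hkI P Z (fun _ => 1) T := by
  unfold hkI
  rw [← integral_sub (hkI_int P hZ hZ0 hf hT) (hkI_int P hZ hZ0 hp hT), ← integral_const_mul]
  refine (abs_integral_le_integral_abs).trans ?_
  refine integral_mono ((hkI_int P hZ hZ0 hf hT).sub (hkI_int P hZ hZ0 hp hT)).abs
    ((hkI_int P hZ hZ0 continuous_const hT).const_mul ε) fun ω => ?_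
  have h1 := h _ (hk_exp_mem (hZ0 ω) hT)
  simp only
  rw [← mul_sub, abs_mul, abs_of_nonneg (sq_nonneg _), abs_sub_comm, mul_one, mul_comm]
  exact mul_le_mul_of_nonneg_right h1 (sq_nonneg _)

lemma hk_poly {D Y : Ω → ℝ} (hD : Measurable D) (hD0 : ∀ ω, 0 ≤ D ω)
    (hY : Measurable Y) (hY0 : ∀ ω, 0 ≤ Y ω) (F : ℝ → ℝ) (c : ℝ)
    (hm : ∀ k : ℕ, Tendsto (fun T => (hkI P D (fun z => z ^ k) T - c * hkI P Y (fun z => z ^ k) T) / F T)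
      atTop (nhds 0)) (p : Polynomial ℝ) :
    Tendsto (fun T => (hkI P D (fun z => p.eval z) T - c * hkI P Y (fun z => p.eval z) T) / F T)
      atTop (nhds 0) := by
  induction p using Polynomial.induction_on' with
  | add p q hp hq =>
    have := hp.add hq
    rw [add_zero] at this
    refine this.congr' ?_
    filter_upwards [eventually_gt_atTop 0] with T hT
    have e : ∀ Z : Ω → ℝ, Measurable Z → (∀ ω, 0 ≤ Z ω) → hkI P Z (fun z => (p + q).eval z) T
        = hkI P Z (fun z => p.eval z) T + hkI P Z (fun z => q.eval z) T := by
      intro Z hZ hZ0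
      unfold hkI
      rw [← integral_add (hkI_int P hZ hZ0 p.continuous hT) (hkI_int P hZ hZ0 q.continuous hT)]
      simp only [Polynomial.eval_add, mul_add]
    rw [e D hD hD0, e Y hY hY0]
    ring
  | monomial n a =>
    have := (hm n).const_mul a
    rw [mul_zero] at this
    refine this.congr fun T => ?_
    have e : ∀ Z : Ω → ℝ, hkI P Z (fun z => ((Polynomial.monomial n) a).eval z) T
        = a * hkI P Z (fun z => z ^ n) T := by
      intro Z
      unfold hkI
      rw [← integral_const_mul]
      simp only [Polynomial.eval_monomial]
      congr 1; ext ω; ring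
    rw [e D, e Y]
    ring

lemma hk_cont {D Y : Ω → ℝ} (hD : Measurable D) (hD0 : ∀ ω, 0 ≤ D ω)
    (hY : Measurable Y) (hY0 : ∀ ω, 0 ≤ Y ω) (F : ℝ → ℝ) (hF : ∀ x, 0 < F x) (c : ℝ) (hc : 0 ≤ c)
    (hm : ∀ k : ℕ, Tendsto (fun T => (hkI P D (fun z => z ^ k) T - c * hkI P Y (fun z => z ^ k) T) / F T)
      atTop (nhds 0)) (K : ℝ) (hK : 0 ≤ K)
    (hb : ∀ᶠ T in atTop, hkI P Y (fun _ => 1) T ≤ K * F T)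
    {f : ℝ → ℝ} (hf : Continuous f) :
    Tendsto (fun T => (hkI P D f T - c * hkI P Y f T) / F T) atTop (nhds 0) := by
  rw [Metric.tendsto_nhds]
  intro ε hε
  set δ := ε / (2 * (1 + 2 * (c * K))) with hδ
  have hδp : 0 < δ := by positivity
  obtain ⟨p, hp⟩ := exists_polynomial_near_of_continuousOn 0 1 f hf.continuousOn δ hδp
  have h1 := (Metric.tendsto_nhds.mp (hk_poly P hD hD0 hY hY0 F c hm p)) (ε / 2) (by positivity)
  have h2 := (hm 0).eventually (gt_mem_nhds (zero_lt_one))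
  filter_upwards [h1, h2, hb, eventually_gt_atTop 0] with T h1 h2 hb hT
  have hFT := hF T
  rw [Real.dist_eq, sub_zero, abs_div, abs_of_pos hFT, div_lt_iff₀ hFT] at h1 ⊢
  simp only [pow_zero] at h2
  rw [div_lt_iff₀ hFT] at h2
  have hD' := hkI_sub P hD hD0 hf p.continuous (fun z hz => (hp z hz).le) hT
  have hY' := hkI_sub P hY hY0 hf p.continuous (fun z hz => (hp z hz).le) hT
  have hcb : c * hkI P Y (fun _ => 1) T ≤ c * (K * F T) := by gcongr
  have e1 : δ * hkI P D (fun _ => 1) T ≤ δ * ((1 + c * K) * F T) := by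
    gcongr; linarith
  have e2 : c * (δ * hkI P Y (fun _ => 1) T) ≤ δ * (c * K * F T) := by
    calc _ = δ * (c * hkI P Y (fun _ => 1) T) := by ring
      _ ≤ δ * (c * (K * F T)) := by gcongr
      _ = _ := by ring
  have e3 : δ * ((1 + c * K) * F T) + δ * (c * K * F T) = ε / 2 * F T := by
    rw [hδ]; field_simp; ring
  have e4 : c * |hkI P Y f T - hkI P Y (fun z => p.eval z) T|
      ≤ c * (δ * hkI P Y (fun _ => 1) T) := by gcongr
  have e5 : |hkI P D f T - c * hkI P Y f T| ≤
      |hkI P D (fun z => p.eval z) T - c * hkI P Y (fun z => p.eval z) T|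
      + |hkI P D f T - hkI P D (fun z => p.eval z) T|
      + c * |hkI P Y f T - hkI P Y (fun z => p.eval z) T| := by
    have : hkI P D f T - c * hkI P Y f T =
      (hkI P D (fun z => p.eval z) T - c * hkI P Y (fun z => p.eval z) T)
      + (hkI P D f T - hkI P D (fun z => p.eval z) T)
      + -(c * (hkI P Y f T - hkI P Y (fun z => p.eval z) T)) := by ring
    rw [this]
    refine (abs_add_three _ _ _).trans ?_
    rw [abs_neg, abs_mul c, abs_of_nonneg hc]
  linarith

noncomputable def hkpsi (a b z : ℝ) : ℝ := max 0 (min 1 ((b - z) / (b - a)))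
noncomputable def hkf (a b z : ℝ) : ℝ := hkpsi a b z / (max (1 - z) (1 - b)) ^ 2

lemma hkpsi_nonneg (a b z : ℝ) : 0 ≤ hkpsi a b z := le_max_left _ _
lemma hkpsi_le_one (a b z : ℝ) : hkpsi a b z ≤ 1 := max_le zero_le_one (min_le_left _ _)
lemma hkpsi_one {a b z : ℝ} (hab : a < b) (hz : z ≤ a) : hkpsi a b z = 1 := by
  unfold hkpsi
  rw [min_eq_left, max_eq_right zero_le_one]
  rw [le_div_iff₀ (by linarith)]; linarith
lemma hkpsi_zero {a b z : ℝ} (hab : a < b) (hz : b ≤ z) : hkpsi a b z = 0 := by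
  unfold hkpsi
  refine max_eq_left ((min_le_right _ _).trans ?_)
  exact div_nonpos_of_nonpos_of_nonneg (by linarith) (by linarith)

lemma hkf_cont {a b : ℝ} (hb : b < 1) : Continuous (hkf a b) := by
  unfold hkf hkpsi
  refine Continuous.div (by fun_prop) (by fun_prop) fun z => ?_
  have : 0 < max (1 - z) (1 - b) := lt_of_lt_of_le (by linarith) (le_max_right _ _)
  positivity

lemma hkf_eq {a b z : ℝ} (hab : a < b) (hb : b < 1) : (1 - z) ^ 2 * hkf a b z = hkpsi a b z := by
  unfold hkf
  rcases le_total z b with h | h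
  · rw [max_eq_left (by linarith)]
    have : 1 - z ≠ 0 := by linarith
    field_simp
  · rw [hkpsi_zero hab h]; simp

lemma hkI_lower {Z : Ω → ℝ} (hZ : Measurable Z) (hZ0 : ∀ ω, 0 ≤ Z ω) {x y : ℝ} (hx : 0 < x)
    (hxy : x < y) {T : ℝ} (hT : 0 < T) :
    P.real {ω | y * T < Z ω} ≤ hkI P Z (hkf (Real.exp (-y)) (Real.exp (-x))) T := by
  have hab : Real.exp (-y) < Real.exp (-x) := Real.exp_lt_exp.mpr (by linarith)
  have hb : Real.exp (-x) < 1 := Real.exp_lt_one_iff.mpr (by linarith)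
  have hm : MeasurableSet {ω | y * T < Z ω} := measurableSet_lt measurable_const hZ
  have e : P.real {ω | y * T < Z ω} = ∫ ω, Set.indicator {ω | y * T < Z ω} (fun _ => (1:ℝ)) ω ∂P := by
    rw [integral_indicator hm]; simp
  rw [e]
  refine integral_mono ((integrable_const _).indicator hm)
    (hkI_int P hZ hZ0 (hkf_cont hb) hT) fun ω => ?_
  simp only
  rw [hkf_eq hab hb]
  simp only [Set.indicator, Set.mem_ofPred_eq]
  split_ifs with h
  · rw [hkpsi_one hab]
    refine Real.exp_le_exp.mpr (neg_le_neg ?_)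
    rw [one_div, ← div_eq_inv_mul, le_div_iff₀ hT]; exact h.le
  · exact hkpsi_nonneg _ _ _

lemma hkI_upper {Z : Ω → ℝ} (hZ : Measurable Z) (hZ0 : ∀ ω, 0 ≤ Z ω) {x y : ℝ} (hx : 0 < x)
    (hxy : x < y) {T : ℝ} (hT : 0 < T) :
    hkI P Z (hkf (Real.exp (-y)) (Real.exp (-x))) T ≤ P.real {ω | x * T < Z ω} := by
  have hab : Real.exp (-y) < Real.exp (-x) := Real.exp_lt_exp.mpr (by linarith)
  have hb : Real.exp (-x) < 1 := Real.exp_lt_one_iff.mpr (by linarith)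
  have hm : MeasurableSet {ω | x * T < Z ω} := measurableSet_lt measurable_const hZ
  have e : P.real {ω | x * T < Z ω} = ∫ ω, Set.indicator {ω | x * T < Z ω} (fun _ => (1:ℝ)) ω ∂P := by
    rw [integral_indicator hm]; simp
  rw [e]
  refine integral_mono (hkI_int P hZ hZ0 (hkf_cont hb) hT)
    ((integrable_const _).indicator hm) fun ω => ?_
  simp only
  rw [hkf_eq hab hb]
  simp only [Set.indicator, Set.mem_ofPred_eq]
  split_ifs with h
  · exact hkpsi_le_one _ _ _
  · rw [hkpsi_zero hab]
    refine Real.exp_le_exp.mpr (neg_le_neg ?_)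
    rw [one_div, ← div_eq_inv_mul, div_le_iff₀ hT]; exact not_lt.mp h

lemma hk_tauber {D Y : Ω → ℝ} (hD : Measurable D) (hD0 : ∀ ω, 0 ≤ D ω)
    (hY : Measurable Y) (hY0 : ∀ ω, 0 ≤ Y ω) {α : ℝ} (h : RegularlyVarying P Y α)
    (c : ℝ) (hc : 0 ≤ c)
    (hm : ∀ k : ℕ, Tendsto (fun T => (hkI P D (fun z => z ^ k) T - c * hkI P Y (fun z => z ^ k) T)
      / P.real {ω | T < Y ω}) atTop (nhds 0)) (K : ℝ) (hK : 0 ≤ K)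
    (hb : ∀ᶠ T in atTop, hkI P Y (fun _ => 1) T ≤ K * P.real {ω | T < Y ω}) :
    Tendsto (fun T => P.real {ω | T < D ω} / P.real {ω | T < Y ω}) atTop (nhds c) := by
  have hcont : Tendsto (fun y : ℝ => c * y ^ (-α)) (nhds 1) (nhds c) := by
    have : ContinuousAt (fun y : ℝ => c * y ^ (-α)) 1 :=
      continuousAt_const.mul (Real.continuousAt_rpow_const _ _ (Or.inl one_ne_zero))
    simpa [ContinuousAt] using this
  have hF := hk_rv_pos P h
  have main : ∀ x y : ℝ, 0 < x → x < y → Tendsto (fun T =>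
      (hkI P D (hkf (Real.exp (-y)) (Real.exp (-x))) T
        - c * hkI P Y (hkf (Real.exp (-y)) (Real.exp (-x))) T)
      / P.real {ω | T < Y ω}) atTop (nhds 0) := fun x y hx hxy =>
    hk_cont P hD hD0 hY hY0 _ hF c hc hm K hK hb (hkf_cont (Real.exp_lt_one_iff.mpr (by linarith)))
  rw [tendsto_order]
  constructor
  · intro a ha
    have h1 : ∀ᶠ y in nhds (1:ℝ), a < c * y ^ (-α) := hcont.eventually (lt_mem_nhds ha)
    obtain ⟨y, hay, hy⟩ := ((h1.filter_mono nhdsWithin_le_nhds).and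
      (self_mem_nhdsWithin : Set.Ioi (1:ℝ) ∈ nhdsWithin 1 (Set.Ioi 1))).exists
    have hy1 : 1 < y := hy
    have h2 := ((hk_rv_lim P h (c := y) (by linarith)).const_mul c).add (main 1 y one_pos hy1)
    rw [add_zero] at h2
    filter_upwards [h2.eventually (lt_mem_nhds hay), eventually_gt_atTop 0] with T h3 hT
    refine h3.trans_le ?_
    rw [mul_div_assoc', ← add_div]
    refine div_le_div_of_nonneg_right ?_ (hF T).le
    have u := hkI_upper P hD hD0 one_pos hy1 hT
    have l := mul_le_mul_of_nonneg_left (hkI_lower P hY hY0 one_pos hy1 hT) hc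
    rw [one_mul] at u
    linarith
  · intro a ha
    have h1 : ∀ᶠ y in nhds (1:ℝ), c * y ^ (-α) < a := hcont.eventually (gt_mem_nhds ha)
    have h0 : ∀ᶠ y in nhds (1:ℝ), 0 < y := lt_mem_nhds one_pos
    obtain ⟨x, ⟨hax, hx0⟩, hx⟩ := (((h1.and h0).filter_mono nhdsWithin_le_nhds).and
      (self_mem_nhdsWithin : Set.Iio (1:ℝ) ∈ nhdsWithin 1 (Set.Iio 1))).exists
    have hx1 : x < 1 := hx
    have h2 := ((hk_rv_lim P h (c := x) hx0).const_mul c).add (main x 1 hx0 hx1)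
    rw [add_zero] at h2
    filter_upwards [h2.eventually (gt_mem_nhds hax), eventually_gt_atTop 0] with T h3 hT
    refine lt_of_le_of_lt ?_ h3
    rw [mul_div_assoc', ← add_div]
    refine div_le_div_of_nonneg_right ?_ (hF T).le
    have u := hkI_lower P hD hD0 hx0 hx1 hT
    have l := mul_le_mul_of_nonneg_left (hkI_upper P hY hY0 hx0 hx1 hT) hc
    rw [one_mul] at u
    linarith

end

section
variable {Ω : Type*} [MeasurableSpace Ω] (P : Measure Ω) [IsProbabilityMeasure P]

noncomputable def hkphi (P : Measure Ω) (Z : Ω → ℝ) (s : ℝ) : ℝ := ∫ ω, Real.exp (-(s * Z ω)) ∂P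

lemma hkphi_int {Z : Ω → ℝ} (hZ : Measurable Z) (hZ0 : ∀ ω, 0 ≤ Z ω) {s : ℝ} (hs : 0 ≤ s) :
    Integrable (fun ω => Real.exp (-(s * Z ω))) P := by
  refine Integrable.of_bound (Measurable.aestronglyMeasurable (by fun_prop)) 1 ?_
  refine Eventually.of_forall fun ω => ?_
  rw [Real.norm_of_nonneg (Real.exp_pos _).le]
  have := mul_nonneg hs (hZ0 ω)
  exact Real.exp_le_one_iff.mpr (by linarith)

lemma hkphi_le_one {Z : Ω → ℝ} (hZ : Measurable Z) (hZ0 : ∀ ω, 0 ≤ Z ω) {s : ℝ} (hs : 0 ≤ s) :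
    hkphi P Z s ≤ 1 := by
  have : hkphi P Z s ≤ ∫ ω, (1:ℝ) ∂P := by
    refine integral_mono (hkphi_int P hZ hZ0 hs) (integrable_const _) fun ω => ?_
    have := mul_nonneg hs (hZ0 ω)
    exact Real.exp_le_one_iff.mpr (by linarith)
  simpa using this

lemma hkI_pow {Z : Ω → ℝ} (hZ : Measurable Z) (hZ0 : ∀ ω, 0 ≤ Z ω) (k : ℕ) {T : ℝ} (hT : 0 < T)
    (m : ℝ) :
    hkI P Z (fun z => z ^ k) T = (hkphi P Z (k * (1 / T)) - 1 + (k * (1 / T)) * m)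
      - 2 * (hkphi P Z ((k + 1 : ℕ) * (1 / T)) - 1 + ((k + 1 : ℕ) * (1 / T)) * m)
      + (hkphi P Z ((k + 2 : ℕ) * (1 / T)) - 1 + ((k + 2 : ℕ) * (1 / T)) * m) := by
  have i : ∀ j : ℕ, Integrable (fun ω => Real.exp (-(j * (1 / T) * Z ω))) P :=
    fun j => hkphi_int P hZ hZ0 (by positivity)
  have e : hkI P Z (fun z => z ^ k) T = hkphi P Z (k * (1 / T))
      - 2 * hkphi P Z ((k + 1 : ℕ) * (1 / T)) + hkphi P Z ((k + 2 : ℕ) * (1 / T)) := by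
    unfold hkI hkphi
    have i2 : Integrable (fun ω => Real.exp (-(k * (1 / T) * Z ω))
        - 2 * Real.exp (-((k + 1 : ℕ) * (1 / T) * Z ω))) P := (i _).sub ((i _).const_mul 2)
    rw [← integral_const_mul, ← integral_sub (i _) ((i _).const_mul 2),
      ← integral_add i2 (i _)]
    congr 1; ext ω
    have e : ∀ j : ℕ, Real.exp (-(j * (1 / T) * Z ω)) = Real.exp (-(1 / T * Z ω)) ^ j := by
      intro j
      rw [← Real.exp_nat_mul]; ring_nf
    rw [e, e, e]
    ring
  rw [e]; push_cast; ring

lemma hkphi_g {Z : Ω → ℝ} (hZ : Measurable Z) (hZ0 : ∀ ω, 0 ≤ Z ω) (hi : Integrable Z P)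
    {s : ℝ} (hs : 0 ≤ s) :
    hkphi P Z s - 1 + s * ∫ ω, Z ω ∂P = ∫ ω, hkg (s * Z ω) ∂P := by
  unfold hkphi hkg
  have i2 : Integrable (fun ω => Real.exp (-(s * Z ω)) - 1) P :=
    (hkphi_int P hZ hZ0 hs).sub (integrable_const _)
  rw [integral_add i2 (hi.const_mul s),
    integral_sub (hkphi_int P hZ hZ0 hs) (integrable_const _), integral_const_mul]
  simp

lemma hk_main_bound (X κA D : Ω → ℝ)
    (hXmeas : Measurable X) (hκAmeas : Measurable κA) (hDmeas : Measurable D)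
    (hXnn : ∀ ω, 0 ≤ X ω) (hκAnn : ∀ ω, 0 ≤ κA ω) (hDnn : ∀ ω, 0 ≤ D ω)
    (hκA1 : Integrable κA P) (hX1 : Integrable X P)
    (κ : ℝ) (hκ : κ = ∫ ω, κA ω ∂P) (hκlt : κ < 1)
    (μD : ℝ) (hμD : μD = (∫ ω, X ω ∂P) / (1 - κ)) (hμ : 0 < μD)
    (hfix : ∀ s : ℝ, 0 ≤ s →
      ∫ ω, Real.exp (-(s * D ω)) ∂P
        = ∫ ω, Real.exp (-(s * X ω))
            * Real.exp (κA ω * ((∫ ω', Real.exp (-(s * D ω')) ∂P) - 1)) ∂P)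
    {s : ℝ} (hs : 0 < s) :
    |(hkphi P D s - 1 + s * μD) - 1 / (1 - κ) * ∫ ω, hkg (s * (X ω + κA ω * μD)) ∂P|
      ≤ (1 / (1 - κ)) ^ 2 / μD * (∫ ω, hkm (s * (X ω + κA ω * μD)) ∂P) ^ 2 / s := by
  have hd : 0 < 1 - κ := by linarith
  set u := 1 - hkphi P D s with hu
  have hu0 : 0 ≤ u := by have := hkphi_le_one P hDmeas hDnn hs.le; linarith
  have hW0 : ∀ ω, 0 ≤ s * X ω + κA ω * u := fun ω => by
    have := hXnn ω; have := hκAnn ω; positivity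
  have hWm : Measurable (fun ω => s * X ω + κA ω * u) := by fun_prop
  have hWi : Integrable (fun ω => s * X ω + κA ω * u) P :=
    (hX1.const_mul s).add (hκA1.mul_const u)
  have hY0 : ∀ ω, 0 ≤ s * (X ω + κA ω * μD) := fun ω => by
    have := hXnn ω; have := hκAnn ω; positivity
  have hYm : Measurable (fun ω => s * (X ω + κA ω * μD)) := by fun_prop
  have hYi : Integrable (fun ω => s * (X ω + κA ω * μD)) P :=
    (hX1.add (hκA1.mul_const μD)).const_mul s
  have hEX : ∫ ω, X ω ∂P = (1 - κ) * μD := by rw [hμD]; field_simp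
  have hV : (1 - κ) * (s * μD - u) = ∫ ω, hkg (s * X ω + κA ω * u) ∂P := by
    have h1 := hkphi_g P hWm hW0 hWi zero_le_one
    simp only [one_mul] at h1
    rw [← h1]
    have h2 : hkphi P (fun ω => s * X ω + κA ω * u) 1 = hkphi P D s := by
      have := hfix s hs.le
      unfold hkphi
      rw [this]
      congr 1; ext ω
      rw [← Real.exp_add]
      congr 1
      rw [hu]; unfold hkphi; ring
    rw [h2, integral_add (hX1.const_mul s) (hκA1.mul_const u), integral_const_mul,
      integral_mul_const, ← hκ, hEX]
    have : hkphi P D s = 1 - u := by rw [hu]; ring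
    rw [this]; ring
  have hus : u ≤ s * μD := by
    have : 0 ≤ (1 - κ) * (s * μD - u) := by
      rw [hV]; exact integral_nonneg fun ω => hkg_nonneg _
    nlinarith [nonneg_of_mul_nonneg_right this hd]
  set G := ∫ ω, hkg (s * (X ω + κA ω * μD)) ∂P with hG
  set H := ∫ ω, hkm (s * (X ω + κA ω * μD)) ∂P with hH
  have hle : ∀ ω, s * X ω + κA ω * u ≤ s * (X ω + κA ω * μD) := fun ω => by
    have := mul_le_mul_of_nonneg_left hus (hκAnn ω); linarith
  have hVG : (1 - κ) * (s * μD - u) ≤ G := by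
    rw [hV]
    exact integral_mono (hkg_int P hWm hW0 hWi) (hkg_int P hYm hY0 hYi)
      fun ω => hkg_mono (hW0 ω) (hle ω)
  have hGH : G ≤ H := integral_mono (hkg_int P hYm hY0 hYi) (hkm_int P hYm hY0 hYi)
      fun ω => hkg_le_hkm (hY0 ω)
  have hH0 : 0 ≤ H := integral_nonneg fun ω => hkm_nonneg (hY0 ω)
  set r := (s * μD - u) / (s * μD) with hr
  have hr0 : 0 ≤ r := div_nonneg (by linarith) (by positivity)
  have hGV : G - (1 - κ) * (s * μD - u) ≤ r * H := by
    rw [hV, hG, hH, ← integral_sub (hkg_int P hYm hY0 hYi) (hkg_int P hWm hW0 hWi),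
      ← integral_const_mul]
    refine integral_mono ((hkg_int P hYm hY0 hYi).sub (hkg_int P hWm hW0 hWi))
      ((hkm_int P hYm hY0 hYi).const_mul r) fun ω => ?_
    refine hk_diff.trans ?_
    have e1 : s * (X ω + κA ω * μD) - (s * X ω + κA ω * u) = r * (s * (κA ω * μD)) := by
      rw [hr]; field_simp; ring
    rw [e1]
    have e2 : r * (s * (κA ω * μD)) ≤ r * (s * (X ω + κA ω * μD)) := by
      have := hXnn ω
      gcongr; linarith
    have e3 : 0 ≤ 1 - Real.exp (-(s * (X ω + κA ω * μD))) := by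
      have := hY0 ω
      have : Real.exp (-(s * (X ω + κA ω * μD))) ≤ 1 := Real.exp_le_one_iff.mpr (by linarith)
      linarith
    calc _ ≤ r * (s * (X ω + κA ω * μD)) * (1 - Real.exp (-(s * (X ω + κA ω * μD)))) := by gcongr
      _ = r * (s * (X ω + κA ω * μD) * (1 - Real.exp (-(s * (X ω + κA ω * μD))))) := by ring
      _ ≤ _ := by have := hk_diff_le (hY0 ω); gcongr
  have hrH : r ≤ H / (1 - κ) / (s * μD) := by
    rw [hr]
    gcongr
    rw [le_div_iff₀ hd]; linarith
  have e : (hkphi P D s - 1 + s * μD) - 1 / (1 - κ) * G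
      = -(1 / (1 - κ) * (G - (1 - κ) * (s * μD - u))) := by
    rw [hu]; field_simp; ring
  rw [e, abs_neg, abs_of_nonneg (mul_nonneg (by positivity) (by linarith))]
  calc 1 / (1 - κ) * (G - (1 - κ) * (s * μD - u)) ≤ 1 / (1 - κ) * (r * H) := by gcongr
    _ ≤ 1 / (1 - κ) * (H / (1 - κ) / (s * μD) * H) := by gcongr
    _ = _ := by field_simp

end

/-- **Regular variation transfer for Hawkes clusters, case α ∈ (1,2).**
If the Laplace transform of `D` satisfies the Hawkes fixed-point equation with
`κ = E[κ_A] < 1`, `E[X] < ∞`, `μ_D = E[X]/(1-κ)`, `X` is regularly varying with index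
`α ∈ (1,2)` and `Y = X + κ_A μ_D` is regularly varying with index `α`, then `D` is regularly
varying with index `α` and `P(D > x) ∼ P(Y > x)/(1-κ)`. -/
theorem hawkes_cluster_regvar_one_two
    {Ω : Type*} [MeasurableSpace Ω] (P : Measure Ω) [IsProbabilityMeasure P]
    (α : ℝ) (hα1 : 1 < α) (hα2 : α < 2)
    (X κA D : Ω → ℝ)
    (hXmeas : Measurable X) (hκAmeas : Measurable κA) (hDmeas : Measurable D)
    (hXnn : ∀ ω, 0 ≤ X ω) (hκAnn : ∀ ω, 0 ≤ κA ω) (hDnn : ∀ ω, 0 ≤ D ω)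
    (hκA1 : Integrable κA P) (hX1 : Integrable X P)
    (κ : ℝ) (hκ : κ = ∫ ω, κA ω ∂P) (hκlt : κ < 1)
    (μD : ℝ) (hμD : μD = (∫ ω, X ω ∂P) / (1 - κ))
    -- the fixed-point equation for the Laplace transform of `D`
    (hfix : ∀ s : ℝ, 0 ≤ s →
      ∫ ω, Real.exp (-(s * D ω)) ∂P
        = ∫ ω, Real.exp (-(s * X ω))
            * Real.exp (κA ω * ((∫ ω', Real.exp (-(s * D ω')) ∂P) - 1)) ∂P)
    -- `X` and `Y = X + κ_A μ_D` are regularly varying with index `α ∈ (1,2)`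
    (hXrv : RegularlyVarying P X α)
    (hYrv : RegularlyVarying P (fun ω => X ω + κA ω * μD) α) :
    RegularlyVarying P D α ∧
    Tendsto
      (fun x : ℝ =>
        (P {ω | x < D ω}).toReal / (P {ω | x < X ω + κA ω * μD}).toReal)
      atTop (nhds (1 / (1 - κ))) := by
  have hd : 0 < 1 - κ := by linarith
  have hEX : 0 < ∫ ω, X ω ∂P := by
    have h1 := hk_A_ge P hXmeas hX1 1
    have h2 := hk_rv_pos P hXrv 1
    have h3 := setIntegral_le_integral (s := {ω | 1 < X ω}) hX1 (Eventually.of_forall hXnn)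
    linarith
  have hμ : 0 < μD := by rw [hμD]; positivity
  set Y : Ω → ℝ := fun ω => X ω + κA ω * μD with hYdef
  have hY : Measurable Y := by fun_prop
  have hY0 : ∀ ω, 0 ≤ Y ω := fun ω => by
    have := hXnn ω; have := hκAnn ω; simp only [hYdef]; positivity
  have hYi : Integrable Y P := hX1.add (hκA1.mul_const μD)
  have hF := hk_rv_pos P hYrv
  set c := 1 / (1 - κ) with hc
  have hc0 : 0 < c := by positivity
  obtain ⟨K, hK, hKb⟩ := hk_H_bound P hY hY0 hYi hα1 hα2 hYrv
  set V : ℝ → ℝ := fun s => hkphi P D s - 1 + s * μD with hV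
  set G : ℝ → ℝ := fun s => hkphi P Y s - 1 + s * ∫ ω, Y ω ∂P with hG
  have hTF : Tendsto (fun T => T * P.real {ω | T < Y ω}) atTop (nhds 0) :=
    tendsto_of_tendsto_of_tendsto_of_le_of_le' tendsto_const_nhds (hk_A_tendsto P hY hYi)
      (by filter_upwards [eventually_ge_atTop 0] with T hT; positivity)
      (Eventually.of_forall fun T => hk_A_ge P hY hYi T)
  have hR : Tendsto (fun T => (V (1 / T) - c * G (1 / T)) / P.real {ω | T < Y ω})
      atTop (nhds 0) := by
    have h1 := hTF.const_mul (c ^ 2 / μD * K ^ 2)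
    rw [mul_zero] at h1
    refine squeeze_zero_norm' ?_ h1
    filter_upwards [hKb, eventually_gt_atTop 0] with T hT hT0
    have hFT := hF T
    rw [norm_div, Real.norm_eq_abs, Real.norm_of_nonneg hFT.le, div_le_iff₀ hFT]
    have hs : 0 < 1 / T := by positivity
    have hb := hk_main_bound P X κA D hXmeas hκAmeas hDmeas hXnn hκAnn hDnn hκA1 hX1 κ hκ hκlt
      μD hμD hμ hfix hs
    have hg := hkphi_g P hY hY0 hYi hs.le
    simp only [hV, hG]
    rw [hg]
    refine hb.trans ?_
    have hH0 : 0 ≤ ∫ ω, hkm (1 / T * Y ω) ∂P := integral_nonneg fun ω =>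
      hkm_nonneg (mul_nonneg hs.le (hY0 ω))
    calc _ ≤ c ^ 2 / μD * (K * P.real {ω | T < Y ω}) ^ 2 / (1 / T) := by gcongr
      _ = _ := by field_simp
  have hRk : ∀ k : ℕ, Tendsto (fun T => (V (k * (1 / T)) - c * G (k * (1 / T)))
      / P.real {ω | T < Y ω}) atTop (nhds 0) := by
    intro k
    rcases Nat.eq_zero_or_pos k with rfl | hk
    · have : V 0 = 0 ∧ G 0 = 0 := by constructor <;> simp [hV, hG, hkphi]
      simp [this]
    · have hk' : (0:ℝ) < (k:ℝ)⁻¹ := by positivity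
      have h1 := (hR.comp (tendsto_id.const_mul_atTop hk')).mul (hk_rv_lim P hYrv hk')
      rw [zero_mul] at h1
      refine h1.congr fun T => ?_
      have h2 := (hF ((k:ℝ)⁻¹ * T)).ne'
      have h3 := (hF T).ne'
      have e : 1 / ((k:ℝ)⁻¹ * T) = k * (1 / T) := by
        rw [one_div, mul_inv, inv_inv, one_div]
      simp only [Function.comp, id]
      rw [e]
      exact div_mul_div_cancel₀ h2
  have hm : ∀ k : ℕ, Tendsto (fun T => (hkI P D (fun z => z ^ k) T - c * hkI P Y (fun z => z ^ k) T)
      / P.real {ω | T < Y ω}) atTop (nhds 0) := by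
    intro k
    have h1 := ((hRk k).sub ((hRk (k + 1)).const_mul 2)).add (hRk (k + 2))
    simp only [mul_zero, sub_zero, add_zero] at h1
    refine h1.congr' ?_
    filter_upwards [eventually_gt_atTop 0] with T hT
    rw [hkI_pow P hDmeas hDnn k hT μD, hkI_pow P hY hY0 k hT (∫ ω, Y ω ∂P)]
    simp only [hV, hG]
    ring
  have hb : ∀ᶠ T in atTop, hkI P Y (fun _ => 1) T ≤ K * P.real {ω | T < Y ω} := by
    filter_upwards [hKb, eventually_gt_atTop 0] with T hT hT0
    refine le_trans ?_ hT
    have hs : 0 < 1 / T := by positivity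
    refine integral_mono (hkI_int P hY hY0 continuous_const hT0)
      (hkm_int P (by fun_prop) (fun ω => mul_nonneg hs.le (hY0 ω)) (hYi.const_mul _)) fun ω => ?_
    have ht := mul_nonneg hs.le (hY0 ω)
    have h1 := Real.add_one_le_exp (-(1 / T * Y ω))
    have h2 := hk_exp_mem (hY0 ω) hT0
    have h3 := h2.1
    have h4 := h2.2
    simp only [mul_one]
    refine le_min ?_ ?_ <;> nlinarith
  have hfin := hk_tauber P hDmeas hDnn hY hY0 hYrv c hc0.le hm K hK hb
  refine ⟨⟨fun x => x ^ α * P.real {ω | x < D ω}, ?_, ?_⟩, hfin⟩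
  · intro a ha
    have h1 := (((hfin.comp (tendsto_id.const_mul_atTop ha)).div hfin hc0.ne').mul
      (hk_rv_lim P hYrv ha)).const_mul (a ^ α)
    rw [div_self hc0.ne', one_mul, ← Real.rpow_add ha, add_neg_cancel, Real.rpow_zero] at h1
    refine h1.congr' ?_
    filter_upwards [eventually_gt_atTop 0] with x hx
    have h2 := (hF (a * x)).ne'
    have h3 := (hF x).ne'
    have h4 := (Real.rpow_pos_of_pos hx α).ne'
    simp only [Function.comp, id, Pi.div_apply]
    rw [Real.mul_rpow ha.le hx.le]
    by_cases h5 : P.real {ω | x < D ω} = 0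
    · rw [h5]; simp
    · field_simp
  · intro x hx
    rw [← mul_assoc, ← Real.rpow_add hx]
    simp [Measure.real]
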